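/- arXiv:2409.08630 — 2 statements merged into one kernel-verified Lean document; each statement's English description precedes it below -/
import Mathlib

section
/- Let I ⊆ ℝ be an open interval and ε₁ ∈ {−1, 1}. Let λ₁, λ₂, λ₃, λ₄, b₂, b₃, b₄, α, φ : I → ℝ be differentiable functions such that λ₂(t), λ₃(t), λ₄(t) are pairwise distinct for every t ∈ I, and for i = 2,3,4: λᵢ' = bᵢ(λᵢ − λ₁), bᵢ' = bᵢ² + ε₁ λ₁ λᵢ, and bᵢ = α λᵢ + φ on I. Then α' = α φ + λ₁ (ε₁ + α²) and φ' = φ² + α λ₁ φ on I. -/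
/-- If `x' = y (x - l)`, `y' = y² + ε l x` and `y = α x + φ` near `t`, then differentiating the
last relation gives an affine relation in `x t` between the derivatives of `α` and `φ`. -/
theorem deriv_affine_relation {I : Set ℝ} (hI : IsOpen I) {t l ε : ℝ} (ht : t ∈ I)
    {x y α φ : ℝ → ℝ} (hx : HasDerivAt x (y t * (x t - l)) t)
    (hy : HasDerivAt y ((y t) ^ 2 + ε * l * x t) t)
    (hα : DifferentiableAt ℝ α t) (hφ : DifferentiableAt ℝ φ t)
    (h : ∀ s ∈ I, y s = α s * x s + φ s) :
    (deriv α t - (α t * φ t + l * (ε + (α t) ^ 2))) * x t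
      + (deriv φ t - ((φ t) ^ 2 + α t * l * φ t)) = 0 := by
  have hd := (hα.hasDerivAt.mul hx).add hφ.hasDerivAt
  have heq : y =ᶠ[nhds t] α * x + φ :=
    Filter.eventually_of_mem (hI.mem_nhds ht) h
  have key := hy.unique (hd.congr_of_eventuallyEq heq)
  rw [h t ht] at key
  linear_combination -key

/-- Equation (3.59) of Lemma 3.4(b): along an integral curve of `e₁`, if
`λⱼ' = bⱼ(λⱼ − λ₁)`, `bⱼ' = bⱼ² + ε₁λ₁λⱼ` and `bⱼ = αλⱼ + φ` (j = 2,3,4) with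
λ₂, λ₃, λ₄ pairwise distinct, then `α' = αφ + λ₁(ε₁ + α²)` and `φ' = φ² + αλ₁φ`. -/
theorem alpha_phi_evolution
    (I : Set ℝ) (hI : ∃ a b : ℝ, I = Set.Ioo a b)
    (ε₁ : ℝ) (hε₁ : ε₁ = 1 ∨ ε₁ = -1)
    (lam₁ lam₂ lam₃ lam₄ b₂ b₃ b₄ α φ : ℝ → ℝ)
    (hdist : ∀ t ∈ I, lam₂ t ≠ lam₃ t ∧ lam₂ t ≠ lam₄ t ∧ lam₃ t ≠ lam₄ t)
    (hlam₂ : ∀ t ∈ I, HasDerivAt lam₂ (b₂ t * (lam₂ t - lam₁ t)) t)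
    (hlam₃ : ∀ t ∈ I, HasDerivAt lam₃ (b₃ t * (lam₃ t - lam₁ t)) t)
    (hlam₄ : ∀ t ∈ I, HasDerivAt lam₄ (b₄ t * (lam₄ t - lam₁ t)) t)
    (hb₂ : ∀ t ∈ I, HasDerivAt b₂ ((b₂ t) ^ 2 + ε₁ * lam₁ t * lam₂ t) t)
    (hb₃ : ∀ t ∈ I, HasDerivAt b₃ ((b₃ t) ^ 2 + ε₁ * lam₁ t * lam₃ t) t)
    (hb₄ : ∀ t ∈ I, HasDerivAt b₄ ((b₄ t) ^ 2 + ε₁ * lam₁ t * lam₄ t) t)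
    (hαdiff : ∀ t ∈ I, DifferentiableAt ℝ α t)
    (hφdiff : ∀ t ∈ I, DifferentiableAt ℝ φ t)
    (hb₂eq : ∀ t ∈ I, b₂ t = α t * lam₂ t + φ t)
    (hb₃eq : ∀ t ∈ I, b₃ t = α t * lam₃ t + φ t)
    (hb₄eq : ∀ t ∈ I, b₄ t = α t * lam₄ t + φ t) :
    (∀ t ∈ I, HasDerivAt α (α t * φ t + lam₁ t * (ε₁ + (α t) ^ 2)) t) ∧
      (∀ t ∈ I, HasDerivAt φ ((φ t) ^ 2 + α t * lam₁ t * φ t) t) := by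
  obtain ⟨a, b, rfl⟩ := hI
  have main : ∀ t ∈ Set.Ioo a b,
      deriv α t = α t * φ t + lam₁ t * (ε₁ + (α t) ^ 2) ∧
        deriv φ t = (φ t) ^ 2 + α t * lam₁ t * φ t := by
    intro t ht
    have h₂ := deriv_affine_relation isOpen_Ioo ht (hlam₂ t ht) (hb₂ t ht)
      (hαdiff t ht) (hφdiff t ht) hb₂eq
    have h₃ := deriv_affine_relation isOpen_Ioo ht (hlam₃ t ht) (hb₃ t ht)
      (hαdiff t ht) (hφdiff t ht) hb₃eq
    have hα : deriv α t - (α t * φ t + lam₁ t * (ε₁ + (α t) ^ 2)) = 0 := by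
      refine (mul_eq_zero.mp ?_).resolve_right (sub_ne_zero.mpr (hdist t ht).1)
      linear_combination h₂ - h₃
    rw [hα, zero_mul, zero_add] at h₂
    exact ⟨sub_eq_zero.mp hα, sub_eq_zero.mp h₂⟩
  exact ⟨fun t ht => (main t ht).1 ▸ (hαdiff t ht).hasDerivAt,
    fun t ht => (main t ht).2 ▸ (hφdiff t ht).hasDerivAt⟩
end

section
/- Let I ⊆ ℝ be an open interval and ε₁ ∈ {−1, 1}. Let λ₁, k, P, α, φ : I → ℝ be functions with λ₁, k, α, φ differentiable, satisfying on I: α' = αφ + λ₁(ε₁ + α²), φ' = φ² + αλ₁φ, λ₁' = −4αλ₁² + (2/3)αk + 2λ₁φ, k' = k(2φ − 5αλ₁) + 6λ₁²φ − 3αP, and the identity −6αλ₁φ + k(α² + ε₁) + 3φ² = 0 holding at every point of I. Then 6(3α²λ₁²φ + φ³) + ε₁(−3αkλ₁ + 2kφ − 3αP) = 3λ₁(6αφ² + α³k) + 3α³P at every point of I. -/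
/-- Equation (4.27): differentiating the identity `−6αλ₁φ + k(α² + ε₁) + 3φ² = 0`
along the integral curve of `e₁` and substituting the evolution equations gives
`6(3α²λ₁²φ + φ³) + ε₁(−3αkλ₁ + 2kφ − 3αP) = 3λ₁(6αφ² + α³k) + 3α³P`. -/
theorem case_II_P_relation
    (I : Set ℝ) (hI : ∃ a b : ℝ, I = Set.Ioo a b)
    (ε₁ : ℝ) (hε₁ : ε₁ = 1 ∨ ε₁ = -1)
    (lam₁ k P α φ : ℝ → ℝ)
    (hα : ∀ t ∈ I, HasDerivAt α (α t * φ t + lam₁ t * (ε₁ + (α t) ^ 2)) t)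
    (hφ : ∀ t ∈ I, HasDerivAt φ ((φ t) ^ 2 + α t * lam₁ t * φ t) t)
    (hlam₁ : ∀ t ∈ I,
      HasDerivAt lam₁
        (-4 * α t * (lam₁ t) ^ 2 + (2 / 3) * α t * k t + 2 * lam₁ t * φ t) t)
    (hk : ∀ t ∈ I,
      HasDerivAt k
        (k t * (2 * φ t - 5 * α t * lam₁ t) + 6 * (lam₁ t) ^ 2 * φ t -
          3 * α t * P t) t)
    (hrel : ∀ t ∈ I,
      -6 * α t * lam₁ t * φ t + k t * ((α t) ^ 2 + ε₁) + 3 * (φ t) ^ 2 = 0) :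
    ∀ t ∈ I,
      6 * (3 * (α t) ^ 2 * (lam₁ t) ^ 2 * φ t + (φ t) ^ 3) +
          ε₁ * (-3 * α t * k t * lam₁ t + 2 * k t * φ t - 3 * α t * P t) =
        3 * lam₁ t * (6 * α t * (φ t) ^ 2 + (α t) ^ 3 * k t) +
          3 * (α t) ^ 3 * P t := by
  obtain ⟨a, b, rfl⟩ := hI
  intro t ht
  have hder := (((((hα t ht).mul (hlam₁ t ht)).mul (hφ t ht)).const_mul (-6)).add
    ((hk t ht).mul (((hα t ht).pow 2).add_const ε₁))).add (((hφ t ht).pow 2).const_mul 3)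
  have hzero : HasDerivAt (fun _ : ℝ => (0 : ℝ)) 0 t := hasDerivAt_const t 0
  have huniq := hder.unique <| hzero.congr_of_eventuallyEq <| by
    filter_upwards [isOpen_Ioo.mem_nhds ht] with s hs
    have hs_rel := hrel s hs
    simp only [Pi.add_apply, Pi.mul_apply, Pi.pow_apply]
    linear_combination hs_rel
  simp only [Pi.mul_apply, Pi.pow_apply] at huniq
  norm_num at huniq
  linear_combination huniq
end
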